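/- Let V be a finite nonempty vertex set and E a directed graph relation on V that is strongly connected and aperiodic (gcd of closed-walk lengths equals 1), in which every vertex has at least one predecessor. Let τ ≥ 0 and let H be the map H(φ)(i) = min( φ(i) + τ , min_{j : E(j,i)} φ(j) ). Then there exists d such that for every φ : V → ℝ, the iterate H^d(φ) is constant, with value min_i φ(i). -/

import Mathlib

/-- A directed walk of length exactly `k` from `u` to `w` in the graph `E`. -/
def Walk {V : Type*} (E : V → V → Prop) (u w : V) (k : ℕ) : Prop :=
  ∃ p : ℕ → V, p 0 = u ∧ p k = w ∧ ∀ m < k, E (p m) (p (m + 1))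

theorem Walk.append' {V : Type*} {E : V → V → Prop} {u v w : V} {a b : ℕ}
    (h₁ : Walk E u v a) (h₂ : Walk E v w b) : Walk E u w (a + b) := by
  obtain ⟨p, hp0, hpa, hp⟩ := h₁
  obtain ⟨q, hq0, hqb, hq⟩ := h₂
  refine ⟨fun m => if m < a then p m else q (m - a), ?_, ?_, ?_⟩
  · by_cases h : 0 < a
    · simp [h, hp0]
    · have : a = 0 := by omega
      subst this
      simp [hq0, ← hpa, hp0]
  · simp [hqb]
  · intro m hm
    by_cases h : m + 1 < a
    · have h' : m < a := by omega
      simpa [h, h'] using hp m h'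
    · by_cases h' : m < a
      · have e : a = m + 1 := by omega
        have := hp m h'
        rw [← e, hpa] at this
        simpa [h, h', e, hq0] using this
      · have e : m + 1 - a = (m - a) + 1 := by omega
        have := hq (m - a) (by omega)
        simpa [h, h', e] using this

theorem primitive_aux {V : Type*} [Fintype V] [Nonempty V]
    (E : V → V → Prop)
    (hconn : ∀ u w : V, ∃ k, 0 < k ∧ Walk E u w k)
    (haper : ∀ d : ℕ, (∀ k, 0 < k → (∃ u, Walk E u u k) → d ∣ k) → d = 1) :
    ∃ d : ℕ, ∀ u w, Walk E u w d := by
  obtain ⟨v⟩ := ‹Nonempty V›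
  let S : AddSubmonoid ℕ :=
    { carrier := {k | Walk E v v k}
      zero_mem' := ⟨fun _ => v, rfl, rfl, by simp⟩
      add_mem' := fun h₁ h₂ => Walk.append' h₁ h₂ }
  have hg : Nat.setGcd (S : Set ℕ) = 1 := by
    apply haper
    rintro k - ⟨u, hu⟩
    obtain ⟨a, -, ha⟩ := hconn v u
    obtain ⟨b, -, hb⟩ := hconn u v
    have h1 : Nat.setGcd (S : Set ℕ) ∣ a + b :=
      Nat.setGcd_dvd_of_mem (show a + b ∈ (S : Set ℕ) from ha.append' hb)
    have h2 : Nat.setGcd (S : Set ℕ) ∣ a + k + b :=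
      Nat.setGcd_dvd_of_mem (show a + k + b ∈ (S : Set ℕ) from (ha.append' hu).append' hb)
    have e : a + k + b = (a + b) + k := by ring
    rw [e] at h2
    exact (Nat.dvd_add_right h1).1 h2
  obtain ⟨N, hN⟩ := Nat.exists_mem_closure_of_ge (S : Set ℕ)
  rw [hg, AddSubmonoid.closure_eq] at hN
  choose a _ ha using fun u => hconn u v
  choose b _ hb using fun w => hconn v w
  refine ⟨(∑ u, a u) + N + ∑ w, b w, fun u w => ?_⟩
  have h1 : a u ≤ ∑ u, a u := Finset.single_le_sum (fun _ _ => Nat.zero_le _) (Finset.mem_univ u)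
  have h2 : b w ≤ ∑ w, b w := Finset.single_le_sum (fun _ _ => Nat.zero_le _) (Finset.mem_univ w)
  have h3 : Walk E v v ((∑ u, a u) + N + (∑ w, b w) - a u - b w) :=
    hN _ (by omega) (one_dvd _)
  have h4 := ((ha u).append' h3).append' (hb w)
  convert h4 using 1
  omega

/-- on a strongly connected aperiodic finite digraph in which
every vertex has a predecessor, some iterate `H^[d]` of the strong-resetting
pulse map sends every `φ` to the constant function `min_i φ i`: the system
synchronizes. -/
theorem strong_resetting_synchronizes_on_aperiodic
    {V : Type*} [Fintype V] [Nonempty V]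
    (E : V → V → Prop) (hE : ∀ i, ∃ j, E j i)
    (hconn : ∀ u w : V, ∃ k, 0 < k ∧ Walk E u w k)
    (haper : ∀ d : ℕ, (∀ k, 0 < k → (∃ u, Walk E u u k) → d ∣ k) → d = 1)
    (τ : ℝ) (hτ : 0 ≤ τ)
    (H : (V → ℝ) → (V → ℝ))
    (hH : ∀ φ i, H φ i = min (φ i + τ) (sInf (φ '' {j | E j i}))) :
    ∃ d : ℕ, ∀ φ : V → ℝ, H^[d] φ = fun _ => ⨅ i, φ i := by
  obtain ⟨d, hd⟩ := primitive_aux E hconn haper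
  refine ⟨d, fun φ => funext fun i => le_antisymm ?_ ?_⟩
  · refine le_ciInf fun u => ?_
    obtain ⟨p, hp0, hpd, hp⟩ := hd u i
    have key : ∀ m ≤ d, H^[m] φ (p m) ≤ φ u := by
      intro m
      induction m with
      | zero => intro _; simp [hp0]
      | succ m ih =>
        intro hm
        rw [Function.iterate_succ_apply', hH]
        refine (min_le_right _ _).trans (le_trans ?_ (ih (by omega)))
        exact csInf_le (Set.toFinite _).bddBelow ⟨p m, hp m (by omega), rfl⟩
    simpa [hpd] using key d le_rfl
  · have key : ∀ m i, ⨅ i, φ i ≤ H^[m] φ i := by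
      intro m
      induction m with
      | zero => exact fun i => ciInf_le (Set.finite_range φ).bddBelow i
      | succ m ih =>
        intro i
        rw [Function.iterate_succ_apply', hH]
        refine le_min (by linarith [ih i]) (le_csInf ?_ ?_)
        · obtain ⟨j, hj⟩ := hE i
          exact ⟨_, j, hj, rfl⟩
        · rintro _ ⟨j, -, rfl⟩
          exact ih j
    exact key d i
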